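/- Let K be a global field and let f ∈ O_K[x] be as in the Setup, with splitting field L and G = Gal(L/K). If p and p′ are primes of O_K not dividing q = r_1⋯r_m such that the Artin symbols [L/K, p] and [L/K, p′] are equal as conjugacy classes of G, then f has a root modulo p if and only if f has a root modulo p′. -/

import Mathlib

open Polynomial

/-- `(O, K)` is a global field pair: `K` is a number field with `O` its ring of integers, or
`K` is a finite separable extension of `F_q(T)` with `O` the integral closure of `F_q[T]`. -/
def IsGlobalFieldPair (O K : Type*) [CommRing O] [Field K] [Algebra O K] : Prop :=
  (NumberField K ∧ IsIntegralClosure O ℤ K) ∨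
  (∃ (Fq : Type) (hFq : Field Fq), Finite Fq ∧
    letI := hFq
    ∃ (h₁ : Algebra (RatFunc Fq) K) (h₂ : Algebra (Polynomial Fq) K),
      letI := h₁
      letI := h₂
      IsScalarTower (Polynomial Fq) (RatFunc Fq) K ∧
      FiniteDimensional (RatFunc Fq) K ∧
      Algebra.IsSeparable (RatFunc Fq) K ∧
      IsIntegralClosure O (Polynomial Fq) K)

/-- `σ` is the Frobenius automorphism attached to a prime `β` of `B` lying over `p`. -/
def IsFrobeniusAt (A K L B : Type*) [CommRing A] [Field K] [Field L] [CommRing B]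
    [Algebra A K] [IsFractionRing A K] [Algebra K L] [Algebra A L] [IsScalarTower A K L]
    [Algebra A B] [Algebra B L] [IsScalarTower A B L] [IsIntegralClosure B A L]
    [FiniteDimensional K L] (σ : L ≃ₐ[K] L) (p : Ideal A) (β : Ideal B) : Prop :=
  β.IsPrime ∧ β.comap (algebraMap A B) = p ∧
    ∀ x : B, galRestrict A K L B σ x - x ^ Nat.card (A ⧸ p) ∈ β

/-- `σ` belongs to the Artin symbol `[L/K, p]`. -/
def MemArtinSymbol (A K L B : Type*) [CommRing A] [Field K] [Field L] [CommRing B]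
    [Algebra A K] [IsFractionRing A K] [Algebra K L] [Algebra A L] [IsScalarTower A K L]
    [Algebra A B] [Algebra B L] [IsScalarTower A B L] [IsIntegralClosure B A L]
    [FiniteDimensional K L] (σ : L ≃ₐ[K] L) (p : Ideal A) : Prop :=
  ∃ β : Ideal B, IsFrobeniusAt A K L B σ p β

section FiniteQuotients

theorem hasFiniteQuotients_polynomial (F : Type*) [Field F] [Finite F] :
    Ring.HasFiniteQuotients F[X] where
  finiteQuotient {I} hI := by
    obtain ⟨g, rfl⟩ := Submodule.IsPrincipal.principal I
    have hg : g ≠ 0 := by rintro rfl; simp at hI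
    have : Module.Finite F (AdjoinRoot g) := (AdjoinRoot.powerBasis hg).finite
    exact (Module.finite_of_finite F : Finite (AdjoinRoot g))

/-- The integral closure of a Dedekind domain with finite quotients in a finite separable extension
has the same properties. No compatible `R`-algebra structure on `O` is assumed. -/
theorem isDedekindDomain_and_hasFiniteQuotients_of_isIntegralClosure
    (R F K O : Type*) [CommRing R] [IsDedekindDomain R] [Ring.HasFiniteQuotients R] [Field F]
    [Algebra R F] [IsFractionRing R F] [Field K] [Algebra F K] [Algebra R K]
    [IsScalarTower R F K] [FiniteDimensional F K] [Algebra.IsSeparable F K]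
    [CommRing O] [Algebra O K] [IsIntegralClosure O R K] :
    IsDedekindDomain O ∧ Ring.HasFiniteQuotients O := by
  have hinj : Function.Injective (algebraMap O K) :=
    IsIntegralClosure.algebraMap_injective O R K
  have hmem (x : R) : algebraMap R K x ∈ (algebraMap O K).range :=
    (IsIntegralClosure.isIntegral_iff (A := O)).1 isIntegral_algebraMap
  let φ : R →+* O :=
    (RingEquiv.ofBijective (algebraMap O K).rangeRestrict
      ⟨fun x y h ↦ hinj (congrArg Subtype.val h), (algebraMap O K).rangeRestrict_surjective⟩
      ).symm.toRingHom.comp ((algebraMap R K).codRestrict _ hmem)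
  let : Algebra R O := φ.toAlgebra
  have : IsScalarTower R O K := .of_algebraMap_eq fun x ↦ by
    have := RingEquiv.apply_symm_apply (RingEquiv.ofBijective (algebraMap O K).rangeRestrict
      ⟨fun x y h ↦ hinj (congrArg Subtype.val h), (algebraMap O K).rangeRestrict_surjective⟩)
      ((algebraMap R K).codRestrict _ hmem x)
    exact (congrArg Subtype.val this).symm
  have : IsDomain O := hinj.isDomain (algebraMap O K)
  have := IsIntegralClosure.finite R F K O
  exact ⟨IsIntegralClosure.isDedekindDomain R F K O, .of_module_finite R O⟩

theorem IsGlobalFieldPair.isDedekindDomain_and_hasFiniteQuotients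
    {O K : Type*} [CommRing O] [Field K] [Algebra O K] (h : IsGlobalFieldPair O K) :
    IsDedekindDomain O ∧ Ring.HasFiniteQuotients O := by
  obtain ⟨_, _⟩ | ⟨F, _, _, _, _, _, _, _, _⟩ := h
  · exact isDedekindDomain_and_hasFiniteQuotients_of_isIntegralClosure ℤ ℚ K O
  · have := hasFiniteQuotients_polynomial F
    exact isDedekindDomain_and_hasFiniteQuotients_of_isIntegralClosure F[X] (RatFunc F) K O

end FiniteQuotients

/-- The leading coefficient of `g` divides the resultant of `g` and its derivative, when the latter
is given by its expression in the roots of `g`. -/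
theorem leadingCoeff_dvd_of_eq_prod_sub {O L : Type*} [CommRing O] [Field L] [Algebra O L]
    (hinj : Function.Injective (algebraMap O L)) (g : O[X]) (hg : 0 < g.natDegree)
    (θ : Fin g.natDegree → L)
    (hroots : g.map (algebraMap O L) =
      C (algebraMap O L g.leadingCoeff) * ∏ j, (X - C (θ j)))
    (r : O)
    (hres : algebraMap O L r = (algebraMap O L g.leadingCoeff) ^ (2 * g.natDegree - 1) *
      ∏ pr ∈ Finset.univ.offDiag, (θ pr.1 - θ pr.2)) :
    g.leadingCoeff ∣ r := by
  classical
  set a := algebraMap O L g.leadingCoeff with ha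
  have ha0 : a ≠ 0 := by
    rw [ha, map_ne_zero_iff _ hinj]
    exact leadingCoeff_ne_zero.2 (by rintro rfl; simp at hg)
  have hdeg : (g.map (algebraMap O L)).natDegree = g.natDegree :=
    natDegree_map_eq_of_injective hinj g
  have hrts : (g.map (algebraMap O L)).roots = Finset.univ.val.map θ := by
    rw [hroots, roots_C_mul _ ha0]
    have := roots_multiset_prod_X_sub_C (Finset.univ.val.map θ)
    rw [Multiset.map_map] at this
    exact this
  have hsplit : (g.map (algebraMap O L)).Splits := by
    rw [hroots]
    exact (Splits.C _).mul (Splits.prod fun j _ ↦ Splits.X_sub_C _)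
  have hder (j : Fin g.natDegree) : eval (θ j) (g.map (algebraMap O L)).derivative =
      a * ∏ k ∈ Finset.univ.erase j, (θ j - θ k) := by
    rw [hroots, derivative_C_mul, eval_C_mul, derivative_prod_finset, eval_finsetSum,
      Finset.sum_eq_single j]
    · simp [eval_prod]
    · intro k _ hkj
      simp only [derivative_X_sub_C, mul_one, eval_prod]
      exact Finset.prod_eq_zero (Finset.mem_erase.2 ⟨hkj.symm, Finset.mem_univ j⟩) (by simp)
    · simp
  have hoff : ∏ j, ∏ k ∈ Finset.univ.erase j, (θ j - θ k) =
      ∏ pr ∈ Finset.univ.offDiag, (θ pr.1 - θ pr.2) := by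
    rw [Finset.prod_sigma']
    refine Finset.prod_bij' (fun x _ ↦ (x.1, x.2)) (fun x _ ↦ ⟨x.1, x.2⟩) ?_ ?_ ?_ ?_ ?_ <;>
      simp +contextual [eq_comm]
  have key := resultant_eq_prod_eval (g.map (algebraMap O L)) (g.map (algebraMap O L)).derivative
    (g.natDegree - 1) (by simpa [hdeg] using natDegree_derivative_le (g.map (algebraMap O L)))
    hsplit
  rw [hrts, Multiset.map_map, leadingCoeff_map_of_injective hinj, hdeg, derivative_map,
    resultant_map_map, resultant_deriv (natDegree_pos_iff_degree_pos.1 hg)] at key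
  rw [← derivative_map] at key
  change _ = a ^ _ * ∏ j, eval (θ j) (g.map (algebraMap O L)).derivative at key
  simp_rw [hder] at key
  rw [Finset.prod_mul_distrib, hoff, Finset.prod_const, Finset.card_univ, Fintype.card_fin,
    ← mul_assoc, ← pow_add, show g.natDegree - 1 + g.natDegree = 2 * g.natDegree - 1 by lia,
    ← hres] at key
  rw [← hinj key]
  exact Dvd.intro_left _ rfl |>.mul_right _

/-- An element of the residue field at `β` fixed by the Frobenius comes from the residue field
at `p`. -/
theorem Ideal.Quotient.exists_algebraMap_sub_mem_of_pow_card_sub_mem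
    {A B : Type*} [CommRing A] [CommRing B] [Algebra A B] (p : Ideal A) [p.IsPrime]
    [Finite (A ⧸ p)] (β : Ideal B) [β.IsPrime] (hβ : β.comap (algebraMap A B) = p)
    (b : B) (hb : b ^ Nat.card (A ⧸ p) - b ∈ β) : ∃ y : A, algebraMap A B y - b ∈ β := by
  classical
  let := Fintype.ofFinite (A ⧸ p)
  let := Fintype.fieldOfDomain (A ⧸ p)
  let φ : A ⧸ p →+* B ⧸ β := Ideal.quotientMap β (algebraMap A B) hβ.ge
  have hroot : (X ^ Fintype.card (A ⧸ p) - X : (A ⧸ p)[X]).map φ |>.IsRoot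
      (Ideal.Quotient.mk β b) := by
    rw [← Ideal.Quotient.eq_zero_iff_mem] at hb
    simpa [Nat.card_eq_fintype_card] using hb
  have hprod : ∏ z : A ⧸ p, (X - C z) = X ^ Fintype.card (A ⧸ p) - X := by
    have hroots := FiniteField.roots_X_pow_card_sub_X (A ⧸ p)
    have hdeg := FiniteField.X_pow_card_sub_X_natDegree_eq (A ⧸ p)
      (Fintype.one_lt_card (α := A ⧸ p))
    have hmonic : (X ^ Fintype.card (A ⧸ p) - X : (A ⧸ p)[X]).Monic :=
      monic_X_pow_sub (by rw [degree_X]; exact_mod_cast Fintype.one_lt_card)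
    have := prod_multiset_X_sub_C_of_monic_of_roots_card_eq hmonic (by rw [hroots, hdeg]; rfl)
    rwa [hroots] at this
  rw [← hprod, Polynomial.map_prod, IsRoot.def, eval_prod,
    Finset.prod_eq_zero_iff] at hroot
  obtain ⟨z, -, hz⟩ := hroot
  obtain ⟨y, rfl⟩ := Ideal.Quotient.mk_surjective z
  refine ⟨y, Ideal.Quotient.eq.1 ?_⟩
  simp only [Polynomial.map_sub, map_X, map_C, eval_sub, eval_X, eval_C, sub_eq_zero] at hz
  exact hz.symm

section Frobenius

variable {O K L B : Type*} [CommRing O] [Field K] [Field L] [CommRing B]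
  [Algebra O K] [IsFractionRing O K] [Algebra K L] [Algebra O L] [IsScalarTower O K L]
  [Algebra O B] [Algebra B L] [IsScalarTower O B L] [IsIntegralClosure B O L]
  [FiniteDimensional K L]

theorem exists_memArtinSymbol [IsDedekindDomain O] [Ring.HasFiniteQuotients O] [IsGalois K L]
    (p : Ideal O) (hp : p.IsPrime) (hp0 : p ≠ ⊥) :
    ∃ σ : L ≃ₐ[K] L, MemArtinSymbol O K L B σ p := by
  have hBL : Function.Injective (algebraMap B L) := IsIntegralClosure.algebraMap_injective B O L
  have hOL : Function.Injective (algebraMap O L) := by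
    rw [IsScalarTower.algebraMap_eq O K L]
    exact (algebraMap K L).injective.comp (IsFractionRing.injective O K)
  have hOB : Function.Injective (algebraMap O B) := by
    rw [IsScalarTower.algebraMap_eq O B L, RingHom.coe_comp] at hOL
    exact hOL.of_comp
  have : IsDomain B := hBL.isDomain (algebraMap B L)
  have : Module.Finite O B := IsIntegralClosure.finite O K L B
  have : Ring.HasFiniteQuotients B := .of_module_finite O B
  obtain ⟨β, hβ, hβp⟩ := Ideal.exists_ideal_over_prime_of_isIntegral_of_isDomain (S := B) p (by
    rw [(RingHom.injective_iff_ker_eq_bot _).1 hOB]; exact bot_le)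
  have hβ0 : β ≠ ⊥ := by
    rintro rfl
    exact hp0 (by rw [← hβp, Ideal.comap_bot_of_injective _ hOB])
  have := Ring.HasFiniteQuotients.finiteQuotient hβ0
  have : IsFractionRing B L := IsIntegralClosure.isFractionRing_of_finite_extension O K L B
  let := IsIntegralClosure.MulSemiringAction O K L B
  have := Algebra.isInvariant_of_isGalois O K L B
  have : SMulCommClass Gal(L/K) O B := ⟨fun σ x y ↦ map_smul (galRestrict O K L B σ) x y⟩
  obtain ⟨σ, hσ⟩ := IsArithFrobAt.exists_of_isInvariant O Gal(L/K) β
  refine ⟨σ, β, hβ, hβp, fun x ↦ ?_⟩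
  have := hσ x
  subst hβp
  exact this

/-- If `g` splits over `L`, then its roots multiplied by its leading coefficient lie in `B`. -/
theorem exists_integral_roots (g : O[X]) (θ : Fin g.natDegree → L)
    (hroots : g.map (algebraMap O L) =
      C (algebraMap O L g.leadingCoeff) * ∏ j, (X - C (θ j))) :
    ∃ b : Fin g.natDegree → B,
      (∀ j, algebraMap B L (b j) = algebraMap O L g.leadingCoeff * θ j) ∧
      ∀ x : O, algebraMap O B (g.leadingCoeff ^ g.natDegree * g.eval x) =
        algebraMap O B g.leadingCoeff *
          ∏ j, (algebraMap O B (g.leadingCoeff * x) - b j) := by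
  have hint (j) : IsIntegral O (algebraMap O L g.leadingCoeff * θ j) := by
    rw [← Algebra.smul_def]
    refine isIntegral_leadingCoeff_smul g (θ j) ?_
    rw [← eval_map_algebraMap, hroots, eval_mul, eval_prod,
      Finset.prod_eq_zero (Finset.mem_univ j) (by simp), mul_zero]
  choose b hb using fun j ↦ (IsIntegralClosure.isIntegral_iff (A := B)).1 (hint j)
  refine ⟨b, hb, fun x ↦ IsIntegralClosure.algebraMap_injective B O L ?_⟩
  have hx : algebraMap O L (g.eval x) =
      algebraMap O L g.leadingCoeff * ∏ j, (algebraMap O L x - θ j) := by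
    rw [← eval_map_apply, hroots]
    simp [eval_prod]
  simp only [map_mul, map_pow, map_prod, map_sub, hb, ← IsScalarTower.algebraMap_apply, hx,
    ← mul_sub, Finset.prod_mul_distrib, Finset.prod_const, Finset.card_univ, Fintype.card_fin]
  ring

/-- If `g` has a root modulo `p`, a Frobenius automorphism at `p` fixes a root of `g`. -/
theorem IsFrobeniusAt.exists_fixed_root {σ : L ≃ₐ[K] L} {p : Ideal O} {β : Ideal B}
    (hσ : IsFrobeniusAt O K L B σ p β)
    (g : O[X]) (θ : Fin g.natDegree → L)
    (hroots : g.map (algebraMap O L) =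
      C (algebraMap O L g.leadingCoeff) * ∏ j, (X - C (θ j)))
    (r : O)
    (hres : algebraMap O L r = (algebraMap O L g.leadingCoeff) ^ (2 * g.natDegree - 1) *
      ∏ pr ∈ Finset.univ.offDiag, (θ pr.1 - θ pr.2))
    (hr : r ∉ p) (ha : g.leadingCoeff ∉ p) (x : O) (hx : g.eval x ∈ p) :
    ∃ j, σ (θ j) = θ j := by
  obtain ⟨hβ, hβp, hfrob⟩ := hσ
  have hp : p.IsPrime := hβp ▸ Ideal.IsPrime.comap _
  have hmem (y : O) : algebraMap O B y ∈ β ↔ y ∈ p := by rw [← hβp, Ideal.mem_comap]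
  have hBL : Function.Injective (algebraMap B L) := IsIntegralClosure.algebraMap_injective B O L
  obtain ⟨b, hb, hgb⟩ := exists_integral_roots (B := B) g θ hroots
  have ha0 : algebraMap O L g.leadingCoeff ≠ 0 := by
    rw [IsScalarTower.algebraMap_apply O K L, Ne, map_eq_zero,
      map_eq_zero_iff _ (IsFractionRing.injective O K)]
    rintro h
    exact ha (h ▸ p.zero_mem)
  have hσO (y : O) : σ (algebraMap O L y) = algebraMap O L y := by
    rw [IsScalarTower.algebraMap_apply O K L, σ.commutes]
  obtain ⟨j, hj⟩ : ∃ j, algebraMap O B (g.leadingCoeff * x) - b j ∈ β := by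
    have := (hmem _).2 (p.mul_mem_left (g.leadingCoeff ^ g.natDegree) hx)
    rw [hgb] at this
    have := (hβ.mem_or_mem this).resolve_left (by rwa [hmem])
    obtain ⟨j, -, hj⟩ := hβ.prod_mem_iff.1 this
    exact ⟨j, hj⟩
  refine ⟨j, ?_⟩
  have hfix : galRestrict O K L B σ (b j) - b j ∈ β := by
    have h₁ := hfrob (b j)
    have h₂ := hfrob (algebraMap O B (g.leadingCoeff * x))
    rw [AlgEquiv.commutes] at h₂
    rw [← Ideal.Quotient.eq] at h₁ h₂ hj ⊢
    rw [h₁, map_pow, ← hj, ← map_pow, ← h₂]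
  obtain ⟨k, hk⟩ : ∃ k, σ (θ j) = θ k := by
    have h0 : (g.map (algebraMap O L)).eval (σ (θ j)) = 0 := by
      have : (g.map (algebraMap O L)).map (σ : L →+* L) = g.map (algebraMap O L) := by
        rw [Polynomial.map_map]
        congr 1
        ext y
        exact hσO y
      rw [← this]
      change eval ((σ : L →+* L) (θ j)) _ = 0
      rw [eval_map_apply, hroots, eval_mul, eval_prod,
        Finset.prod_eq_zero (Finset.mem_univ j) (by simp), mul_zero, map_zero]
    rw [hroots, eval_mul, eval_C, mul_eq_zero, or_iff_right ha0, eval_prod,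
      Finset.prod_eq_zero_iff] at h0
    obtain ⟨k, -, hk⟩ := h0
    exact ⟨k, by simpa [sub_eq_zero] using hk⟩
  by_cases hjk : k = j
  · rwa [hjk] at hk
  exfalso
  have hbk : galRestrict O K L B σ (b j) = b k := hBL <| by
    rw [algebraMap_galRestrict_apply, hb, hb, map_mul, hσO, hk]
  rw [hbk] at hfix
  have hprod : algebraMap O B (r * g.leadingCoeff ^
        (Finset.univ : Finset (Fin g.natDegree)).offDiag.card) =
      algebraMap O B g.leadingCoeff ^ (2 * g.natDegree - 1) *
        ∏ pr ∈ Finset.univ.offDiag, (b pr.1 - b pr.2) := hBL <| by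
    simp only [map_mul, map_pow, map_prod, map_sub, hb, ← IsScalarTower.algebraMap_apply, hres,
      ← mul_sub, Finset.prod_mul_distrib, Finset.prod_const]
    ring
  have hin : algebraMap O B (r * g.leadingCoeff ^
        (Finset.univ : Finset (Fin g.natDegree)).offDiag.card) ∈ β := by
    rw [hprod]
    exact β.mul_mem_left _ (hβ.prod_mem_iff.2 ⟨(k, j), by simpa using hjk, hfix⟩)
  rw [hmem] at hin
  exact (hp.mem_or_mem hin).elim hr fun h ↦ ha (hp.mem_of_pow_mem _ h)

/-- If a Frobenius automorphism at `p` fixes a root of `g`, then `g` has a root modulo `p`. -/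
theorem IsFrobeniusAt.exists_eval_mem {σ : L ≃ₐ[K] L} {p : Ideal O} {β : Ideal B}
    (hσ : IsFrobeniusAt O K L B σ p β) [Finite (O ⧸ p)]
    (g : O[X]) (θ : Fin g.natDegree → L)
    (hroots : g.map (algebraMap O L) =
      C (algebraMap O L g.leadingCoeff) * ∏ j, (X - C (θ j)))
    (ha : g.leadingCoeff ∉ p) (j : Fin g.natDegree) (hj : σ (θ j) = θ j) :
    ∃ x : O, g.eval x ∈ p := by
  obtain ⟨hβ, hβp, hfrob⟩ := hσ
  have hp : p.IsPrime := hβp ▸ Ideal.IsPrime.comap _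
  have hmem (y : O) : algebraMap O B y ∈ β ↔ y ∈ p := by rw [← hβp, Ideal.mem_comap]
  obtain ⟨b, hb, hgb⟩ := exists_integral_roots (B := B) g θ hroots
  have hbj : galRestrict O K L B σ (b j) = b j :=
    IsIntegralClosure.algebraMap_injective B O L <| by
      rw [algebraMap_galRestrict_apply, hb, map_mul, hj, IsScalarTower.algebraMap_apply O K L,
        σ.commutes]
  obtain ⟨y, hy⟩ := Ideal.Quotient.exists_algebraMap_sub_mem_of_pow_card_sub_mem p β hβp (b j) (by
    have := hfrob (b j)
    rw [hbj] at this
    simpa using β.neg_mem this)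
  have hmax : p.IsMaximal :=
    Ideal.Quotient.maximal_of_isField _ (Finite.isField_of_domain (O ⧸ p))
  obtain ⟨c, hc⟩ := hmax.exists_inv ha
  obtain ⟨i, hi, hci⟩ := hc
  refine ⟨c * y, ?_⟩
  have hax : algebraMap O B (g.leadingCoeff * (c * y)) - b j ∈ β := by
    have : algebraMap O B (g.leadingCoeff * (c * y)) - b j =
        algebraMap O B y - b j - algebraMap O B (i * y) := by
      rw [show g.leadingCoeff * (c * y) = y - i * y by linear_combination y * hci]
      rw [map_sub]
      ring
    rw [this]
    exact β.sub_mem hy ((hmem _).2 (p.mul_mem_right _ hi))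
  have hin : algebraMap O B (g.leadingCoeff ^ g.natDegree * g.eval (c * y)) ∈ β := by
    rw [hgb]
    exact β.mul_mem_left _ (hβ.prod_mem_iff.2 ⟨j, Finset.mem_univ j, hax⟩)
  rw [hmem] at hin
  exact (hp.mem_or_mem hin).resolve_left fun h ↦ ha (hp.mem_of_pow_mem _ h)

end Frobenius

theorem isGalois_of_isSplittingField_prod_separable {K L : Type*} [Field K] [Field L]
    [Algebra K L] {ι : Type*} [Fintype ι] (g : ι → K[X]) (hsep : ∀ i, (g i).Separable)
    (e : ι → ℕ) (c : K) (f : K[X]) (hf : f = C c * ∏ i, g i ^ e i) [IsSplittingField K L f] :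
    IsGalois K L := by
  have hnormal : Normal K L := .of_isSplittingField f
  suffices Algebra.IsSeparable K L from ⟨⟩
  rw [← IntermediateField.isSeparable_top, ← (isSplittingField_iff_intermediateField.mp ‹IsSplittingField K L f›).2,
    IntermediateField.isSeparable_adjoin_iff_isSeparable]
  intro x hx
  obtain ⟨hf0, hx⟩ := mem_rootSet.1 hx
  have hc : c ≠ 0 := by rintro rfl; simp [hf] at hf0
  rw [hf, map_mul, aeval_C, mul_eq_zero, or_iff_right (by simpa using hc), map_prod,
    Finset.prod_eq_zero_iff] at hx
  obtain ⟨i, -, hi⟩ := hx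
  rw [map_pow] at hi
  exact (hsep i).of_dvd (minpoly.dvd K x (eq_zero_of_pow_eq_zero hi))

/-- Let `K` be a global field with ring of integers `O` and let `f ∈ O[x]`
be a primitive polynomial whose distinct irreducible factors `g i` are separable, with
splitting field `L`, `B` the integral closure of `O` in `L`, and resultants `r i` of `g i`
and `g i '`.  If `p` and `p'` are primes of `O` not dividing `q = ∏ r i` whose Artin symbols
`[L/K, p]` and `[L/K, p']` coincide (as conjugacy classes of `Gal(L/K)`), then `f` has a root
modulo `p` if and only if `f` has a root modulo `p'`. -/
theorem statement18
    (O K : Type*) [CommRing O] [Field K] [Algebra O K] [IsFractionRing O K]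
    (hglobal : IsGlobalFieldPair O K)
    (L : Type*) [Field L] [Algebra K L] [FiniteDimensional K L]
    [Algebra O L] [IsScalarTower O K L]
    (B : Type*) [CommRing B] [Algebra O B] [Algebra B L] [IsScalarTower O B L]
    [IsIntegralClosure B O L]
    (f : O[X]) (hprim : f.IsPrimitive)
    (m : ℕ) (g : Fin m → O[X])
    (hirr : ∀ i, Irreducible (g i))
    (hsep : ∀ i, ((g i).map (algebraMap O K)).Separable)
    (hdist : ∀ i j, i ≠ j → ¬ Associated (g i) (g j))
    (e : Fin m → ℕ) (he : ∀ i, 1 ≤ e i) (u : Oˣ)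
    (hfact : f = C (u : O) * ∏ i, g i ^ e i)
    [IsSplittingField K L (f.map (algebraMap O K))]
    -- the roots of each irreducible factor in `L` and the resultants `r i`
    (θ : (i : Fin m) → Fin (g i).natDegree → L)
    (hroots : ∀ i, (g i).map (algebraMap O L) =
      C (algebraMap O L (g i).leadingCoeff) * ∏ j, (X - C (θ i j)))
    (r : Fin m → O)
    (hres : ∀ i, algebraMap O L (r i) =
      (algebraMap O L (g i).leadingCoeff) ^ (2 * (g i).natDegree - 1) *
        ∏ pr ∈ Finset.univ.offDiag, (θ i pr.1 - θ i pr.2))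
    (p p' : Ideal O) (hp : p.IsPrime) (hp' : p'.IsPrime)
    (hp0 : p ≠ ⊥) (hp'0 : p' ≠ ⊥)
    (hpq : (∏ i, r i) ∉ p) (hp'q : (∏ i, r i) ∉ p')
    (hsymb : ∀ σ : L ≃ₐ[K] L, MemArtinSymbol O K L B σ p ↔ MemArtinSymbol O K L B σ p') :
    (∃ x : O, f.eval x ∈ p) ↔ (∃ x : O, f.eval x ∈ p') := by
  obtain ⟨_, _⟩ := hglobal.isDedekindDomain_and_hasFiniteQuotients
  have hOL : Function.Injective (algebraMap O L) := by
    rw [IsScalarTower.algebraMap_eq O K L]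
    exact (algebraMap K L).injective.comp (IsFractionRing.injective O K)
  have : IsGalois K L := isGalois_of_isSplittingField_prod_separable
    (fun i ↦ (g i).map (algebraMap O K)) hsep e (algebraMap O K u) (f.map (algebraMap O K))
    (by simp [hfact, Polynomial.map_prod])
  have hdeg (i) : 0 < (g i).natDegree := by
    by_contra! h
    have hC := eq_C_of_natDegree_le_zero h
    have hdvd : g i ∣ f := by
      rw [hfact]
      exact ((dvd_pow_self _ (Nat.one_le_iff_ne_zero.1 (he i))).trans
        (Finset.dvd_prod_of_mem (fun i ↦ g i ^ e i) (Finset.mem_univ i))).mul_left _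
    rw [hC] at hdvd
    exact (hirr i).not_isUnit (hC ▸ (hprim _ hdvd).map C)
  have hlc (i) : (g i).leadingCoeff ∣ r i :=
    leadingCoeff_dvd_of_eq_prod_sub hOL (g i) (hdeg i) (θ i) (hroots i) (r i) (hres i)
  have heval (x : O) : f.eval x = u * ∏ i, (g i).eval x ^ e i := by
    simp [hfact, eval_prod]
  have hri {P : Ideal O} (hP : (∏ i, r i) ∉ P) (i) : r i ∉ P := fun h ↦
    hP (P.mem_of_dvd (Finset.dvd_prod_of_mem r (Finset.mem_univ i)) h)
  have key (P P' : Ideal O) (hP : P.IsPrime) (hP0 : P ≠ ⊥) (hP'0 : P' ≠ ⊥)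
      (hPq : (∏ i, r i) ∉ P) (hP'q : (∏ i, r i) ∉ P')
      (h : ∀ σ : L ≃ₐ[K] L, MemArtinSymbol O K L B σ P → MemArtinSymbol O K L B σ P') :
      (∃ x : O, f.eval x ∈ P) → ∃ x : O, f.eval x ∈ P' := by
    rintro ⟨x, hx⟩
    have := Ring.HasFiniteQuotients.finiteQuotient hP'0
    rw [heval] at hx
    have hu : (u : O) ∉ P := fun h ↦ hP.ne_top (P.eq_top_of_isUnit_mem h u.isUnit)
    obtain ⟨i, -, hi⟩ := hP.prod_mem_iff.1 ((hP.mem_or_mem hx).resolve_left hu)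
    obtain ⟨σ, hσ⟩ := exists_memArtinSymbol (K := K) (L := L) (B := B) P hP hP0
    obtain ⟨β', hβ'⟩ := h σ hσ
    obtain ⟨β, hβ⟩ := hσ
    obtain ⟨j, hj⟩ := hβ.exists_fixed_root (g i) (θ i) (hroots i) (r i) (hres i) (hri hPq i)
      (fun h ↦ hri hPq i (P.mem_of_dvd (hlc i) h)) x (hP.mem_of_pow_mem _ hi)
    obtain ⟨y, hy⟩ := hβ'.exists_eval_mem (g i) (θ i) (hroots i)
      (fun h ↦ hri hP'q i (P'.mem_of_dvd (hlc i) h)) j hj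
    refine ⟨y, ?_⟩
    rw [heval]
    exact P'.mul_mem_left _ (P'.mem_of_dvd ((dvd_pow_self _
      (Nat.one_le_iff_ne_zero.1 (he i))).trans (Finset.dvd_prod_of_mem
        (fun i ↦ (g i).eval y ^ e i) (Finset.mem_univ i))) hy)
  exact ⟨key p p' hp hp0 hp'0 hpq hp'q fun σ ↦ (hsymb σ).1,
    key p' p hp' hp'0 hp0 hp'q hpq fun σ ↦ (hsymb σ).2⟩
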